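/- arXiv:1908.06697 — 2 statements merged into one kernel-verified Lean document; each statement's English description precedes it below -/
import Mathlib

section
/- Let G be a subcubic simple graph and suppose H is an induced subgraph of G, on vertices v0,...,v7. Then in every good coloring of G: if v1 is colored red and its neighbor v2 in H is also colored red, then both v4 and v5 are colored blue; symmetrically, if v0 is colored red and its neighbor v7 in H is also colored red, then both v4 and v5 are colored blue. -/
/-- A 2-coloring of the vertices is encoded by `red : V → Prop`;
`red v` means `v` is colored red, otherwise `v` is blue.
A *good coloring* requires:
(1) the subgraph induced by blue vertices has maximum degree at most 1,
(2) the subgraph induced by red vertices has minimum degree at least 1,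
(3) the subgraph induced by red vertices contains no path on 4 vertices. -/
def IsGoodColoring {V : Type*} (G : SimpleGraph V) (red : V → Prop) : Prop :=
  (∀ v w₁ w₂ : V, ¬ red v → ¬ red w₁ → ¬ red w₂ →
      G.Adj v w₁ → G.Adj v w₂ → w₁ = w₂) ∧
  (∀ v : V, red v → ∃ w : V, red w ∧ G.Adj v w) ∧
  (∀ a b c d : V, red a → red b → red c → red d →
      a ≠ c → a ≠ d → b ≠ d →
      ¬ (G.Adj a b ∧ G.Adj b c ∧ G.Adj c d))

/-- A graph is subcubic if every vertex has degree at most 3. -/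
def Subcubic {V : Type*} (G : SimpleGraph V) : Prop :=
  ∀ v : V, (G.neighborSet v).encard ≤ 3

/-- Adjacency in the graph `H`: the 8-cycle `v₀v₁…v₇v₀` together with the
two chords `v₂v₆` and `v₃v₇`. -/
def HAdj (i j : Fin 8) : Prop :=
  (j = i + 1 ∨ i = j + 1) ∨
  (i = 2 ∧ j = 6) ∨ (i = 6 ∧ j = 2) ∨ (i = 3 ∧ j = 7) ∨ (i = 7 ∧ j = 3)

/-- In a subcubic graph, three distinct neighbors of a vertex are all of its neighbors. -/
theorem Subcubic.eq_or_eq_or_eq {V : Type*} {G : SimpleGraph V} (hG : Subcubic G)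
    {u a b c w : V} (hab : a ≠ b) (hac : a ≠ c) (hbc : b ≠ c)
    (ha : G.Adj u a) (hb : G.Adj u b) (hc : G.Adj u c) (hw : G.Adj u w) :
    w = a ∨ w = b ∨ w = c := by
  by_contra! h
  obtain ⟨hwa, hwb, hwc⟩ := h
  have hsub : ({w, a, b, c} : Set V) ⊆ G.neighborSet u := by
    rintro x (rfl | rfl | rfl | rfl) <;> assumption
  have hcard : ({w, a, b, c} : Set V).encard = 4 := by
    rw [Set.encard_insert_of_notMem (by simp [hwa, hwb, hwc]),
      Set.encard_insert_of_notMem (by simp [hab, hac]), Set.encard_pair hbc]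
    norm_num
  have hle := (Set.encard_le_encard hsub).trans (hG u)
  rw [hcard] at hle
  exact absurd hle (by decide)

instance : DecidableRel HAdj := fun i j => by unfold HAdj; infer_instance

/-- The reflection `i ↦ 1 - i` is an automorphism of `H`. -/
theorem hAdj_one_sub (i j : Fin 8) : HAdj (1 - i) (1 - j) ↔ HAdj i j := by
  revert i j
  decide

/-- If `v₁` and `v₂` are red in a good coloring, then `v₄` and `v₅` are blue. -/
theorem v4_v5_blue_of_red_v1_v2 {V : Type*} {G : SimpleGraph V}
    (hG : Subcubic G) {v : Fin 8 → V} (hinj : Function.Injective v)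
    (hind : ∀ i j : Fin 8, G.Adj (v i) (v j) ↔ HAdj i j)
    {red : V → Prop} (hgood : IsGoodColoring G red) (h1 : red (v 1)) (h2 : red (v 2)) :
    ¬ red (v 4) ∧ ¬ red (v 5) := by
  obtain ⟨hblue, hred, hpath⟩ := hgood
  have adj (i j : Fin 8) (h : HAdj i j) : G.Adj (v i) (v j) := (hind i j).2 h
  have noPath (i j k l : Fin 8) (hik : i ≠ k) (hil : i ≠ l) (hjl : j ≠ l)
      (hij : HAdj i j) (hjk : HAdj j k) (hkl : HAdj k l)
      (ri : red (v i)) (rj : red (v j)) (rk : red (v k)) : ¬ red (v l) := fun rl =>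
    hpath _ _ _ _ ri rj rk rl (hinj.ne hik) (hinj.ne hil) (hinj.ne hjl)
      ⟨adj _ _ hij, adj _ _ hjk, adj _ _ hkl⟩
  have redOfBlue (i j k : Fin 8) (hjk : j ≠ k) (hij : HAdj i j) (hik : HAdj i k)
      (bi : ¬ red (v i)) (bj : ¬ red (v j)) : red (v k) := by
    by_contra bk
    exact hinj.ne hjk (hblue _ _ _ bi bj bk (adj _ _ hij) (adj _ _ hik))
  by_cases h3 : red (v 3)
  · have b0 := noPath 3 2 1 0 (by decide) (by decide) (by decide) (by decide) (by decide)
      (by decide) h3 h2 h1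
    have b7 := noPath 1 2 3 7 (by decide) (by decide) (by decide) (by decide) (by decide)
      (by decide) h1 h2 h3
    have r6 := redOfBlue 7 0 6 (by decide) (by decide) (by decide) b7 b0
    exact ⟨noPath 1 2 3 4 (by decide) (by decide) (by decide) (by decide) (by decide)
        (by decide) h1 h2 h3,
      noPath 1 2 6 5 (by decide) (by decide) (by decide) (by decide) (by decide)
        (by decide) h1 h2 r6⟩
  · exfalso
    by_cases h6 : red (v 6)
    · have b7 := noPath 1 2 6 7 (by decide) (by decide) (by decide) (by decide) (by decide)
        (by decide) h1 h2 h6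
      have r0 := redOfBlue 7 3 0 (by decide) (by decide) (by decide) b7 h3
      exact noPath 6 2 1 0 (by decide) (by decide) (by decide) (by decide) (by decide)
        (by decide) h6 h2 h1 r0
    · have r7 : red (v 7) := by
        by_contra b7
        exact h6 (redOfBlue 7 3 6 (by decide) (by decide) (by decide) b7 h3)
      obtain ⟨w, hwred, hw⟩ := hred _ r7
      rcases hG.eq_or_eq_or_eq (hinj.ne (by decide : (3 : Fin 8) ≠ 6))
        (hinj.ne (by decide : (3 : Fin 8) ≠ 0)) (hinj.ne (by decide : (6 : Fin 8) ≠ 0))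
        (adj 7 3 (by decide)) (adj 7 6 (by decide)) (adj 7 0 (by decide)) hw
        with rfl | rfl | rfl
      · exact h3 hwred
      · exact h6 hwred
      · exact noPath 2 1 0 7 (by decide) (by decide) (by decide) (by decide) (by decide)
          (by decide) h2 h1 hwred r7

/-- If `H` is an induced subgraph of a subcubic graph `G`, then in every good
coloring of `G`: if one of `v₀, v₁` is colored red and its neighbor in `H`
(`v₇` resp. `v₂`) is also colored red, then both `v₄` and `v₅` are blue. -/
theorem v4_v5_blue {V : Type*} (G : SimpleGraph V)
    (hG : Subcubic G) (v : Fin 8 → V) (hinj : Function.Injective v)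
    (hind : ∀ i j : Fin 8, G.Adj (v i) (v j) ↔ HAdj i j)
    (red : V → Prop) (hgood : IsGoodColoring G red) :
    (red (v 1) → red (v 2) → ¬ red (v 4) ∧ ¬ red (v 5)) ∧
    (red (v 0) → red (v 7) → ¬ red (v 4) ∧ ¬ red (v 5)) := by
  refine ⟨v4_v5_blue_of_red_v1_v2 hG hinj hind hgood, fun h0 h7 => ?_⟩
  exact (v4_v5_blue_of_red_v1_v2 (v := fun i => v (1 - i)) hG
    (hinj.comp sub_right_injective) (fun i j => (hind _ _).trans (hAdj_one_sub i j))
    hgood h0 h7).symm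
end

section
/- For every natural number n there exists a simple graph G on more than n vertices such that G is cubic (3-regular), G is 3-connected, and G has no good coloring. In other words, there is an infinite family of 3-connected cubic graphs having no good coloring. -/
/-- A graph is 3-regular and remains connected after removing fewer than three vertices. -/
def IsThreeConnectedCubic {V : Type*} (G : SimpleGraph V) : Prop :=
  (∀ v : V, (G.neighborSet v).encard = 3) ∧
    ∀ S : Set V, S.ncard < 3 → (G.induce Sᶜ).Connected

/-- Three disjoint copies of `H`, joined cyclically through their vertices `v₀` and `v₁`, with one
further edge joining the vertices `v₄` of the first two copies. -/
structure IsObstruction {V : Type*} (G : SimpleGraph V) (φ : Fin 3 × Fin 8 → V) : Prop where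
  injective : Function.Injective φ
  adj_copy : ∀ a i j, HAdj i j → G.Adj (φ (a, i)) (φ (a, j))
  adj_cyclic : ∀ a, G.Adj (φ (a, 0)) (φ (a + 1, 1))
  adj_link : G.Adj (φ (0, 4)) (φ (1, 4))

instance inst_s5 : DecidableRel HAdj := fun _ _ => by
  unfold HAdj
  infer_instance

/-! ### Colorings of cubic graphs containing the obstruction -/

section Coloring

variable {V : Type*} {G : SimpleGraph V}

theorem eq_of_adj_of_encard_eq_three {v a b c w : V}
    (hv : (G.neighborSet v).encard = 3) (ha : G.Adj v a) (hb : G.Adj v b) (hc : G.Adj v c)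
    (hab : a ≠ b) (hac : a ≠ c) (hbc : b ≠ c) (hw : G.Adj v w) : w = a ∨ w = b ∨ w = c := by
  have hsub : ({a, b, c} : Set V) ⊆ G.neighborSet v := by
    rintro x (rfl | rfl | rfl) <;> assumption
  have hcard : ({a, b, c} : Set V).encard = 3 :=
    Set.encard_eq_three.2 ⟨a, b, c, hab, hac, hbc, rfl⟩
  have heq := (Set.toFinite {a, b, c}).eq_of_subset_of_encard_le hsub (by rw [hv, hcard])
  have : w ∈ ({a, b, c} : Set V) := heq ▸ hw
  simpa using this

theorem IsGoodColoring.red_of_adj {red : V → Prop} (h : IsGoodColoring G red) {v a b c : V}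
    (hv : (G.neighborSet v).encard = 3) (ha : G.Adj v a) (hb : G.Adj v b) (hc : G.Adj v c)
    (hab : a ≠ b) (hac : a ≠ c) (hbc : b ≠ c) (hred : red v) : red a ∨ red b ∨ red c := by
  obtain ⟨w, hw, hvw⟩ := h.2.1 v hred
  rcases eq_of_adj_of_encard_eq_three hv ha hb hc hab hac hbc hvw with rfl | rfl | rfl <;> tauto

/-- How a good coloring of a cubic graph restricts to a copy of `H`, where `p` and `q` are the
neighbors of `v₀` and `v₁` outside the copy. -/
theorem IsGoodColoring.restrict_copy {red : V → Prop} (h : IsGoodColoring G red)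
    (hG : ∀ v : V, (G.neighborSet v).encard = 3) {f : Fin 8 → V} (hf : Function.Injective f)
    (hadj : ∀ i j, HAdj i j → G.Adj (f i) (f j)) {p q : V} (hp : G.Adj (f 0) p)
    (hq : G.Adj (f 1) q) (hpf : ∀ i, p ≠ f i) (hqf : ∀ i, q ≠ f i) :
    ¬ (red (f 0) ∧ red (f 1)) ∧
    (¬ red (f 0) → ¬ red (f 1) → red p ∧ red q) ∧
    (red (f 0) → ¬ red p → red q ∧ ¬ red (f 4) ∧ ¬ red (f 5)) ∧
    (red (f 1) → ¬ red q → red p ∧ ¬ red (f 4) ∧ ¬ red (f 5)) := by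
  have hne : ∀ i j, i ≠ j → f i ≠ f j := fun i j hij => hf.ne hij
  have blue : ∀ v i j : Fin 8, HAdj v i ∧ HAdj v j ∧ i ≠ j →
      red (f v) ∨ red (f i) ∨ red (f j) := by
    rintro v i j ⟨hi, hj, hij⟩
    by_contra! hcon
    exact hne i j hij (h.1 _ _ _ hcon.1 hcon.2.1 hcon.2.2 (hadj _ _ hi) (hadj _ _ hj))
  have path : ∀ i j k l : Fin 8, HAdj i j ∧ HAdj j k ∧ HAdj k l ∧ i ≠ k ∧ i ≠ l ∧ j ≠ l →
      ¬ (red (f i) ∧ red (f j) ∧ red (f k) ∧ red (f l)) := by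
    rintro i j k l ⟨hij, hjk, hkl, hik, hil, hjl⟩ ⟨h1, h2, h3, h4⟩
    exact h.2.2 _ _ _ _ h1 h2 h3 h4 (hne _ _ hik) (hne _ _ hil) (hne _ _ hjl)
      ⟨hadj _ _ hij, hadj _ _ hjk, hadj _ _ hkl⟩
  have inner : ∀ v i j k : Fin 8, HAdj v i ∧ HAdj v j ∧ HAdj v k ∧ i ≠ j ∧ i ≠ k ∧ j ≠ k →
      red (f v) → red (f i) ∨ red (f j) ∨ red (f k) := by
    rintro v i j k ⟨hi, hj, hk, hij, hik, hjk⟩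
    exact h.red_of_adj (hG _) (hadj _ _ hi) (hadj _ _ hj) (hadj _ _ hk)
      (hne _ _ hij) (hne _ _ hik) (hne _ _ hjk)
  have outer : ∀ (v i j : Fin 8) (o : V), HAdj v i ∧ HAdj v j ∧ i ≠ j → G.Adj (f v) o →
      (∀ i, o ≠ f i) → (red (f v) → red o ∨ red (f i) ∨ red (f j)) ∧
        (red (f v) ∨ red o ∨ red (f i)) := by
    rintro v i j o ⟨hi, hj, hij⟩ ho hof
    refine ⟨h.red_of_adj (hG _) ho (hadj _ _ hi) (hadj _ _ hj) (hof _) (hof _) (hne _ _ hij), ?_⟩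
    by_contra! hcon
    exact hof i (h.1 _ _ _ hcon.1 hcon.2.1 hcon.2.2 ho (hadj _ _ hi))
  have := path 7 0 1 2 (by decide)
  have := path 0 1 2 3 (by decide)
  have := path 0 1 2 6 (by decide)
  have := path 1 2 3 7 (by decide)
  have := path 6 2 3 4 (by decide)
  have := path 3 4 5 6 (by decide)
  have := path 5 6 7 3 (by decide)
  have := path 2 6 7 0 (by decide)
  have := path 6 7 0 1 (by decide)
  have := path 3 7 0 1 (by decide)
  have := path 1 2 6 7 (by decide)
  have := path 3 2 6 5 (by decide)
  have := path 2 3 7 0 (by decide)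
  have := path 4 3 7 0 (by decide)
  have := inner 2 1 3 6 (by decide)
  have := inner 3 2 4 7 (by decide)
  have := inner 6 5 7 2 (by decide)
  have := inner 7 6 0 3 (by decide)
  have := blue 2 1 3 (by decide)
  have := blue 2 1 6 (by decide)
  have := blue 2 3 6 (by decide)
  have := blue 3 2 7 (by decide)
  have := blue 6 7 2 (by decide)
  have := blue 7 6 0 (by decide)
  have := blue 7 6 3 (by decide)
  have := blue 7 0 3 (by decide)
  have := outer 0 1 7 p (by decide) hp hpf
  have := outer 1 0 2 q (by decide) hq hqf
  have := outer 0 7 1 p (by decide) hp hpf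
  have := outer 1 2 0 q (by decide) hq hqf
  clear blue path inner outer hne hadj hf hG h hp hq hpf hqf
  grind (splits := 30)

theorem IsObstruction.not_isGoodColoring {φ : Fin 3 × Fin 8 → V} (hφ : IsObstruction G φ)
    (hG : ∀ v : V, (G.neighborSet v).encard = 3) (red : V → Prop) : ¬ IsGoodColoring G red := by
  intro h
  have key (a : Fin 3) := h.restrict_copy hG (f := fun i => φ (a, i))
    (fun i j hij => by simpa using hφ.injective hij) (hφ.adj_copy a)
    (hφ.adj_cyclic a) (q := φ (a + 2, 0))
    (by
      have := (hφ.adj_cyclic (a + 2)).symm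
      rwa [add_assoc, show (2 + 1 : Fin 3) = 0 from rfl, add_zero] at this)
    (fun i hi => by simpa using hφ.injective hi)
    (fun i hi => by simpa using hφ.injective hi)
  have hlink : red (φ (0, 4)) ∨ red (φ (0, 5)) ∨ red (φ (1, 4)) := by
    by_contra! hcon
    have := h.1 _ _ _ hcon.1 hcon.2.1 hcon.2.2 (hφ.adj_copy 0 4 5 (by decide))
      hφ.adj_link
    simpa using hφ.injective this
  have h0 := key 0
  have h1 := key 1
  have h2 := key 2
  simp only [Fin.isValue, zero_add, show (1 + 1 : Fin 3) = 2 from rfl,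
    show (1 + 2 : Fin 3) = 0 from rfl, show (2 + 1 : Fin 3) = 0 from rfl,
    show (2 + 2 : Fin 3) = 1 from rfl] at h0 h1 h2
  grind

end Coloring

/-! ### Connectivity after removing vertices -/

section Connectivity

variable {V : Type*} {G : SimpleGraph V}

theorem connected_induce_compl_iff {S : Set V} :
    (G.induce Sᶜ).Connected ↔
      ∃ r, r ∉ S ∧ ∀ P : V → Prop, P r →
        (∀ a b, a ∉ S → b ∉ S → P a → G.Adj a b → P b) → ∀ v, v ∉ S → P v := by
  rw [SimpleGraph.connected_iff_exists_forall_reachable]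
  constructor
  · rintro ⟨⟨r, hr⟩, h⟩
    refine ⟨r, hr, fun P hPr hP v hv => ?_⟩
    obtain ⟨w⟩ := h ⟨v, hv⟩
    have walk : ∀ x y : (Sᶜ : Set V), (G.induce Sᶜ).Walk x y → P x → P y := by
      intro x y w
      induction w with
      | nil => exact id
      | @cons a b _ hadj _ ih => exact fun ha => ih (hP a b a.2 b.2 ha hadj)
    exact walk _ _ w hPr
  · rintro ⟨r, hr, h⟩
    refine ⟨⟨r, hr⟩, fun ⟨v, hv⟩ => ?_⟩
    obtain ⟨_, h'⟩ := h (fun x => ∃ hx : x ∈ Sᶜ, (G.induce Sᶜ).Reachable ⟨r, hr⟩ ⟨x, hx⟩)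
      ⟨hr, .refl _⟩ (fun a b _ hb ⟨ha, hra⟩ hab =>
        ⟨hb, hra.trans (SimpleGraph.Adj.reachable (by simpa using hab))⟩) v hv
    exact h'

end Connectivity

/-! ### Replacing a vertex by a triangle -/

section Truncation

variable {V : Type*}

/-- The graph obtained from `G` by replacing `v` by a triangle whose `i`-th vertex is joined
to `n i`. -/
def truncateAt (G : SimpleGraph V) (v : V) (n : Fin 3 → V) :
    SimpleGraph ({u : V // u ≠ v} ⊕ Fin 3) where
  Adj
    | .inl u, .inl w => G.Adj u w
    | .inl u, .inr i => (u : V) = n i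
    | .inr i, .inl u => (u : V) = n i
    | .inr i, .inr j => i ≠ j
  symm := ⟨by
    rintro (u | i) (w | j) h
    · exact h.symm
    · exact h
    · exact h
    · exact Ne.symm h⟩
  loopless := ⟨by
    rintro (u | i) h
    · exact G.loopless.irrefl _ h
    · exact h rfl⟩

/-- The map contracting the new triangle back to `v`. -/
def contractTo (v : V) : {u : V // u ≠ v} ⊕ Fin 3 → V :=
  Sum.elim Subtype.val fun _ => v

variable {G : SimpleGraph V} {v : V} {n : Fin 3 → V}

theorem encard_neighborSet_truncateAt (hG : ∀ v : V, (G.neighborSet v).encard = 3)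
    (hn : Function.Injective n) (hv : ∀ w, G.Adj v w ↔ ∃ i, n i = w)
    (x : {u : V // u ≠ v} ⊕ Fin 3) : ((truncateAt G v n).neighborSet x).encard = 3 := by
  rcases x with u | i
  · have hinj : Set.InjOn (contractTo v) ((truncateAt G v n).neighborSet (.inl u)) := by
      rintro (w | i) hw (z | j) hz h
      · exact congrArg Sum.inl (Subtype.ext h)
      · exact absurd h w.2
      · exact absurd h.symm z.2
      · exact congrArg Sum.inr (hn ((show (u : V) = n i from hw).symm.trans hz))
    rw [← hinj.encard_image, ← hG u]
    congr 1
    ext w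
    constructor
    · rintro ⟨z | i, hz, rfl⟩
      · exact hz
      · exact ((hv _).2 ⟨i, (show (u : V) = n i from hz).symm⟩).symm
    · intro hw
      by_cases hwv : w = v
      · subst hwv
        obtain ⟨i, hi⟩ := (hv _).1 (G.adj_symm hw)
        exact ⟨.inr i, hi.symm, rfl⟩
      · exact ⟨.inl ⟨w, hwv⟩, hw, rfl⟩
  · have hi : n i ≠ v := fun h => (G.ne_of_adj ((hv _).2 ⟨i, rfl⟩)) h.symm
    have : (truncateAt G v n).neighborSet (.inr i) =
        {.inl ⟨n i, hi⟩, .inr (i + 1), .inr (i + 2)} := by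
      ext (u | j)
      · simp [truncateAt, Subtype.ext_iff]
      · simp only [SimpleGraph.mem_neighborSet, truncateAt, Set.mem_insert_iff, reduceCtorEq,
          Set.mem_singleton_iff, Sum.inr.injEq, false_or]
        clear hi
        revert i j
        decide
    rw [this, Set.encard_eq_three]
    exact ⟨_, _, _, by simp, by simp, by simp, rfl⟩

theorem connected_truncateAt_compl [Finite V]
    (hG : ∀ S : Set V, S.ncard < 3 → (G.induce Sᶜ).Connected)
    (hn : Function.Injective n) (hv : ∀ w, G.Adj v w ↔ ∃ i, n i = w)
    (S : Set ({u : V // u ≠ v} ⊕ Fin 3)) (hS : S.ncard < 3) :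
    ((truncateAt G v n).induce Sᶜ).Connected := by
  have hnv (i) : n i ≠ v := fun h => (G.ne_of_adj ((hv _).2 ⟨i, rfl⟩)) h.symm
  have hT := connected_induce_compl_iff.1 <|
    hG (contractTo v '' S) ((Set.ncard_image_le S.toFinite).trans_lt hS)
  obtain ⟨r, hr, hconn⟩ := hT
  have hmem (u) (hu : u ≠ v) : u ∈ contractTo v '' S ↔ .inl ⟨u, hu⟩ ∈ S := by
    constructor
    · rintro ⟨w | i, hw, rfl⟩
      · exact hw
      · exact absurd rfl hu
    · exact fun h => ⟨_, h, rfl⟩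
  rw [connected_induce_compl_iff]
  by_cases hex : ∃ j, .inr j ∈ S
  · obtain ⟨j, hj⟩ := hex
    have hvT : v ∈ contractTo v '' S := ⟨_, hj, rfl⟩
    have hrv : r ≠ v := fun h => hr (h ▸ hvT)
    refine ⟨.inl ⟨r, hrv⟩, fun h => hr ((hmem r hrv).2 h), fun P hPr hP => ?_⟩
    have hinl : ∀ u (hu : u ≠ v), .inl ⟨u, hu⟩ ∉ S → P (.inl ⟨u, hu⟩) := by
      intro u hu huS
      refine hconn (fun u => ∀ hu : u ≠ v, P (.inl ⟨u, hu⟩)) (fun _ => hPr) ?_ u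
        (fun h => huS ((hmem u hu).1 h)) hu
      intro a b ha hb hPa hab hbv
      have hav : a ≠ v := fun h => ha (h ▸ hvT)
      exact hP (.inl ⟨a, hav⟩) _ (fun h => ha ((hmem a hav).2 h))
        (fun h => hb ((hmem b hbv).2 h)) (hPa hav) hab
    rintro (⟨u, hu⟩ | i) hi
    · exact hinl u hu hi
    · by_cases hni : .inl ⟨n i, hnv i⟩ ∈ S
      · have hij : i ≠ j := fun h => hi (h ▸ hj)
        obtain ⟨k, hki, hkj⟩ : ∃ k, k ≠ i ∧ k ≠ j :=
          (by decide : ∀ i j : Fin 3, ∃ k, k ≠ i ∧ k ≠ j) i j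
        have hSeq : ({.inl ⟨n i, hnv i⟩, .inr j} : Set _) = S := by
          refine Set.eq_of_subset_of_ncard_le ?_ ?_ S.toFinite
          · rintro x (rfl | rfl) <;> assumption
          · rw [Set.ncard_pair (by simp)]
            omega
        have hkS : .inr k ∉ S := by simp [← hSeq, hkj]
        have hnk : .inl ⟨n k, hnv k⟩ ∉ S := by simp [← hSeq, hn.ne hki]
        exact hP (.inr k) _ hkS hi (hP _ _ hnk hkS (hinl _ _ hnk) rfl) hki
      · exact hP _ _ hni hi (hinl _ _ hni) rfl
  · push Not at hex
    have hvT : v ∉ contractTo v '' S := by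
      rintro ⟨w | i, hw, h⟩
      · exact w.2 h
      · exact hex i hw
    have hpre (x) : x ∉ S → contractTo v x ∉ contractTo v '' S := by
      rcases x with u | i
      · exact fun h h' => h ((hmem u u.2).1 h')
      · exact fun _ => hvT
    have hpre' (x) : contractTo v x ∉ contractTo v '' S → x ∉ S :=
      fun h hx => h ⟨x, hx, rfl⟩
    have hsurj : ∀ u, ∃ x, contractTo v x = u := by
      intro u
      by_cases hu : u = v
      · exact ⟨.inr 0, hu.symm⟩
      · exact ⟨.inl ⟨u, hu⟩, rfl⟩
    obtain ⟨r', rfl⟩ := hsurj r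
    refine ⟨r', hpre' _ hr, fun P hPr hP => ?_⟩
    have htri (i j) (h : P (.inr i)) : P (.inr j) := by
      by_cases hij : i = j
      · exact hij ▸ h
      · exact hP _ _ (hex i) (hex j) h hij
    intro x hx
    refine hconn (fun u => ∀ x, contractTo v x = u → P x) ?_ ?_ _ (hpre x hx) x rfl
    · rintro (u | i) hu
      · rcases r' with w | j
        · rwa [show u = w from Subtype.ext hu]
        · exact absurd hu u.2
      · rcases r' with w | j
        · exact absurd hu.symm w.2
        · exact htri j i hPr
    · rintro a b ha hb hPa hab (⟨y, hy⟩ | i) rfl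
      · by_cases hav : a = v
        · subst hav
          obtain ⟨i, rfl⟩ := (hv _).1 hab
          exact hP (.inr i) _ (hex i) (hpre' _ hb) (hPa _ rfl) rfl
        · exact hP (.inl ⟨a, hav⟩) _ (hpre' _ ha) (hpre' _ hb) (hPa _ rfl) hab
      · obtain ⟨j, rfl⟩ := (hv a).1 hab.symm
        exact htri j i (hP (.inl ⟨n j, hnv j⟩) _ (hpre' _ ha) (hex j) (hPa _ rfl) rfl)

theorem IsObstruction.truncateAt {φ : Fin 3 × Fin 8 → V} (hφ : IsObstruction G φ)
    (hφv : ∀ x, φ x ≠ v) (n : Fin 3 → V) :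
    IsObstruction (truncateAt G v n) fun x => .inl ⟨φ x, hφv x⟩ where
  injective _ _ h := hφ.injective (congrArg Subtype.val (Sum.inl_injective h))
  adj_copy := hφ.adj_copy
  adj_cyclic := hφ.adj_cyclic
  adj_link := hφ.adj_link

theorem exists_neighbor_enumeration (hv : (G.neighborSet v).encard = 3) :
    ∃ n : Fin 3 → V, Function.Injective n ∧ ∀ w, G.Adj v w ↔ ∃ i, n i = w := by
  obtain ⟨a, b, c, hab, hac, hbc, h⟩ := Set.encard_eq_three.1 hv
  refine ⟨![a, b, c], ?_, fun w => ?_⟩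
  · intro i j
    fin_cases i <;> fin_cases j <;> simp [hab, hac, hbc, hab.symm, hac.symm, hbc.symm]
  · rw [← SimpleGraph.mem_neighborSet, h]
    simp [Fin.exists_fin_succ, eq_comm]

end Truncation

/-! ### A 3-connected cubic graph containing the obstruction -/

/-- The edges of `baseGraph`: vertex `8 * a + i` is the vertex `vᵢ` of the `a`-th copy of `H`. -/
def baseEdges : List (Fin 26 × Fin 26) :=
  [(0, 1), (1, 2), (2, 3), (3, 4), (4, 5), (5, 6), (6, 7), (7, 0), (2, 6), (3, 7),
    (8, 9), (9, 10), (10, 11), (11, 12), (12, 13), (13, 14), (14, 15), (15, 8), (10, 14), (11, 15),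
    (16, 17), (17, 18), (18, 19), (19, 20), (20, 21), (21, 22), (22, 23), (23, 16), (18, 22),
    (19, 23), (0, 9), (8, 17), (16, 1), (4, 12), (24, 25), (24, 5), (24, 20), (25, 13), (25, 21)]

/-- Three copies of `H` forming an obstruction, and two further adjacent vertices `24` and `25`. -/
def baseGraph : SimpleGraph (Fin 26) where
  Adj i j := (i, j) ∈ baseEdges ∨ (j, i) ∈ baseEdges
  symm := ⟨fun _ _ h => h.symm⟩
  loopless := ⟨by
    unfold baseEdges
    decide +kernel⟩

instance : DecidableRel baseGraph.Adj := fun i j =>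
  inferInstanceAs (Decidable ((i, j) ∈ baseEdges ∨ (j, i) ∈ baseEdges))

theorem encard_neighborSet_baseGraph (v : Fin 26) : (baseGraph.neighborSet v).encard = 3 := by
  rw [← SimpleGraph.coe_neighborFinset, Set.encard_coe_eq_coe_finsetCard]
  have : ∀ v, (baseGraph.neighborFinset v).card = 3 := by decide +kernel
  rw [this v]
  rfl

/-- Bit masks of vertices: one round of propagation along all edges, avoiding `s` and `t`. -/
def propagate (s t : Fin 26) (X : ℕ) : ℕ :=
  (baseEdges ++ baseEdges.map Prod.swap).foldl (init := X) fun X e =>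
    if X.testBit e.1 ∧ e.2 ≠ s ∧ e.2 ≠ t then X ||| 2 ^ (e.2 : ℕ) else X

theorem propagate_sound {s t : Fin 26} {P : Fin 26 → Prop}
    (hP : ∀ a b, (b ≠ s ∧ b ≠ t) → P a → baseGraph.Adj a b → P b) (X : ℕ)
    (hX : ∀ i : Fin 26, X.testBit i → P i) (i : Fin 26) (hi : (propagate s t X).testBit i) :
    P i := by
  have fold : ∀ (L : List (Fin 26 × Fin 26)) (X : ℕ), (∀ e ∈ L, baseGraph.Adj e.1 e.2) →
      (∀ i : Fin 26, X.testBit i → P i) →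
      ∀ i : Fin 26, (L.foldl (init := X) fun X e =>
        if X.testBit e.1 ∧ e.2 ≠ s ∧ e.2 ≠ t then X ||| 2 ^ (e.2 : ℕ) else X).testBit i → P i := by
    intro L
    induction L with
    | nil => exact fun _ _ hX => hX
    | cons e L ih =>
      intro X hL hX
      refine ih _ (fun e he => hL e (List.mem_cons_of_mem _ he)) fun i hi => ?_
      dsimp only at hi
      split_ifs at hi with hc
      · rw [Nat.testBit_or, Bool.or_eq_true, Nat.testBit_two_pow] at hi
        rcases hi with hi | hi
        · exact hX i hi
        · obtain rfl : e.2 = i := Fin.ext (by simpa using hi)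
          exact hP _ _ hc.2 (hX _ hc.1) (hL e List.mem_cons_self)
      · exact hX i hi
  refine fold _ X (fun e he => ?_) hX i hi
  rcases List.mem_append.1 he with he | he
  · exact Or.inl he
  · obtain ⟨e', he', rfl⟩ := List.mem_map.1 he
    exact Or.inr he'

theorem exists_propagate_covers : ∀ s t : Fin 26, ∃ r : Fin 26, (r ≠ s ∧ r ≠ t) ∧
    ∀ i : Fin 26, i ≠ s → i ≠ t →
      ((propagate s t)^[4] (2 ^ (r : ℕ))).testBit i := by
  decide +kernel

theorem connected_baseGraph_compl_pair (s t : Fin 26) :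
    (baseGraph.induce ({s, t} : Set (Fin 26))ᶜ).Connected := by
  rw [connected_induce_compl_iff]
  simp only [Set.mem_insert_iff, Set.mem_singleton_iff, not_or]
  obtain ⟨r, hr, hcover⟩ := exists_propagate_covers s t
  refine ⟨r, hr, fun P hPr hP v hv => ?_⟩
  suffices ∀ k, ∀ i : Fin 26, ((propagate s t)^[k] (2 ^ (r : ℕ))).testBit i →
      P i ∧ i ≠ s ∧ i ≠ t from (this 4 v (hcover v hv.1 hv.2)).1
  intro k
  induction k with
  | zero =>
    intro i hi
    obtain rfl : r = i := Fin.ext (by simpa [Nat.testBit_two_pow] using hi)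
    exact ⟨hPr, hr⟩
  | succ k ih =>
    rw [Function.iterate_succ_apply']
    exact propagate_sound (P := fun i => P i ∧ i ≠ s ∧ i ≠ t)
      (fun a b hb ha hab => ⟨hP a b ha.2 hb ha.1 hab, hb⟩) _ ih

theorem connected_baseGraph_compl (S : Set (Fin 26)) (hS : S.ncard < 3) :
    (baseGraph.induce Sᶜ).Connected := by
  obtain h | h | h : S.ncard = 0 ∨ S.ncard = 1 ∨ S.ncard = 2 := by omega
  · obtain rfl := (Set.ncard_eq_zero S.toFinite).1 h
    obtain ⟨r, -, hr⟩ := connected_induce_compl_iff.1 (connected_baseGraph_compl_pair 0 0)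
    refine connected_induce_compl_iff.2 ⟨r, id, fun P hPr hP => ?_⟩
    have hP' (a b) : P a → baseGraph.Adj a b → P b := hP a b id id
    have hpos (v : Fin 26) (hv : v ≠ 0) : P v :=
      hr P hPr (fun a b _ _ => hP' a b) v (by simpa using hv)
    intro v _
    by_cases hv : v = 0
    · subst hv
      exact hP' 1 0 (hpos 1 (by decide)) (by decide)
    · exact hpos v hv
  · obtain ⟨s, rfl⟩ := Set.ncard_eq_one.1 h
    exact Set.pair_eq_singleton s ▸ connected_baseGraph_compl_pair s s
  · obtain ⟨s, t, -, rfl⟩ := Set.ncard_eq_two.1 h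
    exact connected_baseGraph_compl_pair s t

theorem isThreeConnectedCubic_baseGraph : IsThreeConnectedCubic baseGraph :=
  ⟨encard_neighborSet_baseGraph, connected_baseGraph_compl⟩

/-- The position of the obstruction in `baseGraph`. -/
def baseEmbedding (x : Fin 3 × Fin 8) : Fin 26 := ⟨8 * x.1 + x.2, by omega⟩

theorem isObstruction_baseGraph : IsObstruction baseGraph baseEmbedding where
  injective := by
    unfold Function.Injective
    decide +kernel
  adj_copy := by decide +kernel
  adj_cyclic := by decide +kernel
  adj_link := by decide +kernel

/-! ### The infinite family -/

theorem exists_isThreeConnectedCubic_isObstruction (n : ℕ) :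
    ∃ (V : Type) (_ : Fintype V) (G : SimpleGraph V) (φ : Fin 3 × Fin 8 → V) (v : V),
      n + 3 < Fintype.card V ∧ IsThreeConnectedCubic G ∧ IsObstruction G φ ∧ ∀ x, φ x ≠ v := by
  classical
  induction n with
  | zero =>
    exact ⟨Fin 26, inferInstance, baseGraph, baseEmbedding, 24, by simp,
      isThreeConnectedCubic_baseGraph, isObstruction_baseGraph, by decide +kernel⟩
  | succ n ih =>
    obtain ⟨V, _, G, φ, v, hcard, hG, hφ, hφv⟩ := ih
    obtain ⟨m, hm, hv⟩ := exists_neighbor_enumeration (hG.1 v)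
    refine ⟨{u : V // u ≠ v} ⊕ Fin 3, inferInstance, truncateAt G v m,
      fun x => .inl ⟨φ x, hφv x⟩, .inr 0, ?_,
      ⟨encard_neighborSet_truncateAt hG.1 hm hv, connected_truncateAt_compl hG.2 hm hv⟩,
      hφ.truncateAt hφv m, by simp⟩
    have : Fintype.card {u : V // u ≠ v} = Fintype.card V - 1 := by
      simp [Fintype.card_subtype_compl]
    rw [Fintype.card_sum, this, Fintype.card_fin]
    omega

/-- There is an infinite family of 3-connected cubic graphs having no good
coloring: for every `n` there is a graph on more than `n` vertices which is
cubic (3-regular), 3-connected (more than 3 vertices and connected after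
removing any fewer than 3 vertices) and has no good coloring. -/
theorem infinitely_many_counterexamples (n : ℕ) :
    ∃ (V : Type) (_ : Fintype V) (G : SimpleGraph V),
      n < Fintype.card V ∧
      (∀ v : V, (G.neighborSet v).encard = 3) ∧
      3 < Fintype.card V ∧
      (∀ S : Set V, S.ncard < 3 → (G.induce Sᶜ).Connected) ∧
      ¬ ∃ red : V → Prop, IsGoodColoring G red := by
  obtain ⟨V, hV, G, φ, v, hcard, hG, hφ, -⟩ := exists_isThreeConnectedCubic_isObstruction n
  exact ⟨V, hV, G, by omega, hG.1, by omega, hG.2,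
    fun ⟨red, h⟩ => hφ.not_isGoodColoring hG.1 red h⟩
end
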